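/- Let c := (log₂ 3 - 1)/2. For every real α ∈ [-1/10, 1/10], the binary entropy function satisfies (3/4 - α/2) · h( (1/4 + cα)/(3/4 - α/2) ) ≤ (3/4)·h(1/3) - 0.7·α². -/

import Mathlib

/-- The binary entropy function `h(p) = -p·log₂ p - (1-p)·log₂(1-p)`
(with the convention `h(0) = h(1) = 0`, which holds since `Real.logb 2 0 = 0`). -/
noncomputable def binEntropy (p : ℝ) : ℝ :=
  -(p * Real.logb 2 p) - (1 - p) * Real.logb 2 (1 - p)

lemma abs_log_one_add_sub_taylor_le {t : ℝ} (ht : |t| < 1) :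
    |Real.log (1 + t) - (t - t ^ 2 / 2 + t ^ 3 / 3)| ≤ t ^ 4 / (1 - |t|) := by
  have h := Real.abs_log_sub_add_sum_range_le (x := -t) (by rwa [abs_neg]) 3
  have h4 : |t| ^ 4 = t ^ 4 := by rw [← abs_pow, abs_of_nonneg (by positivity)]
  simp only [Finset.sum_range_succ, Finset.sum_range_zero, abs_neg, sub_neg_eq_add] at h
  norm_num [h4] at h
  convert h using 2
  ring

lemma le_one_add_mul_log_one_add {t : ℝ} (ht : |t| ≤ 0.16) :
    t + 0.445 * t ^ 2 ≤ (1 + t) * Real.log (1 + t) := by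
  have h := (abs_le.mp (abs_log_one_add_sub_taylor_le (t := t) (by linarith))).1
  have hdiv : t ^ 4 / (1 - |t|) ≤ 1.2 * t ^ 4 := by
    rw [div_le_iff₀ (by linarith)]
    nlinarith [show 0 ≤ t ^ 4 by positivity]
  obtain ⟨h1, h2⟩ := abs_le.mp ht
  have hlog : t - t ^ 2 / 2 + t ^ 3 / 3 - 1.2 * t ^ 4 ≤ Real.log (1 + t) := by linarith
  have hmul := mul_le_mul_of_nonneg_left hlog (show 0 ≤ 1 + t by linarith)
  have hpoly : 0 ≤ t ^ 2 * (0.055 - t / 6 + t ^ 2 / 3 - 1.2 * t ^ 2 * (1 + t)) :=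
    mul_nonneg (sq_nonneg t) (by
      nlinarith [mul_nonneg (sub_nonneg.2 h1) (sub_nonneg.2 h2),
      mul_nonneg (sq_nonneg t) (sub_nonneg.2 h2)])
  linarith

lemma one_add_mul_log_one_add_le {t : ℝ} (ht : |t| ≤ 0.07) :
    (1 + t) * Real.log (1 + t) ≤ t + 0.52 * t ^ 2 := by
  have h := (abs_le.mp (abs_log_one_add_sub_taylor_le (t := t) (by linarith))).2
  have hdiv : t ^ 4 / (1 - |t|) ≤ 1.2 * t ^ 4 := by
    rw [div_le_iff₀ (by linarith)]
    nlinarith [show 0 ≤ t ^ 4 by positivity]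
  obtain ⟨h1, h2⟩ := abs_le.mp ht
  have hlog : Real.log (1 + t) ≤ t - t ^ 2 / 2 + t ^ 3 / 3 + 1.2 * t ^ 4 := by linarith
  have hmul := mul_le_mul_of_nonneg_left hlog (show 0 ≤ 1 + t by linarith)
  have hpoly : 0 ≤ t ^ 2 * (0.02 + t / 6 - t ^ 2 / 3 - 1.2 * t ^ 2 * (1 + t)) :=
    mul_nonneg (sq_nonneg t) (by
      nlinarith [mul_nonneg (sub_nonneg.2 h1) (sub_nonneg.2 h2),
      mul_nonneg (sq_nonneg t) (sub_nonneg.2 h2)])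
  linarith

lemma logb_two_three_mem_Icc : Real.logb 2 3 ∈ Set.Icc (1.58 : ℝ) 1.6 := by
  have hlog : 0 < Real.log 2 := Real.log_pos (by norm_num)
  have hlower := Real.log_le_log (by norm_num) (show (2 : ℝ) ^ 19 ≤ 3 ^ 12 by norm_num)
  have hupper := Real.log_le_log (by norm_num) (show (3 : ℝ) ^ 5 ≤ 2 ^ 8 by norm_num)
  simp only [Real.log_pow] at hlower hupper
  push_cast at hlower hupper
  rw [Real.logb, Set.mem_Icc, le_div_iff₀ hlog, div_le_iff₀ hlog]
  constructor <;> linarith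

lemma mul_binEntropy_div_mul_log_two {a s : ℝ} (ha : 0 < a) (has : a < s) :
    s * binEntropy (a / s) * Real.log 2 =
      s * Real.log s - a * Real.log a - (s - a) * Real.log (s - a) := by
  have hs : 0 < s := ha.trans has
  have hlog : Real.log 2 ≠ 0 := (Real.log_pos (by norm_num)).ne'
  have hsub : 1 - a / s = (s - a) / s := by field_simp
  rw [binEntropy, hsub, Real.logb, Real.logb, Real.log_div ha.ne' hs.ne',
    Real.log_div (sub_pos.2 has).ne' hs.ne']
  field_simp
  ring

/-- with `c := (log₂ 3 - 1)/2`, for every `α ∈ [-1/10, 1/10]`,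
`(3/4 - α/2) · h((1/4 + cα)/(3/4 - α/2)) ≤ (3/4)·h(1/3) - 0.7·α²`. -/
theorem stmt_15 (α : ℝ) (hα : α ∈ Set.Icc (-(1 / 10) : ℝ) (1 / 10)) :
    (3 / 4 - α / 2) *
        binEntropy ((1 / 4 + ((Real.logb 2 3 - 1) / 2) * α) / (3 / 4 - α / 2)) ≤
      (3 / 4) * binEntropy (1 / 3) - 0.7 * α ^ 2 := by
  have hlog2 : 0 < Real.log 2 := Real.log_pos (by norm_num)
  obtain ⟨hL1, hL2⟩ := logb_two_three_mem_Icc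
  have hlog3 : Real.log 3 = Real.logb 2 3 * Real.log 2 := by
    rw [Real.logb, div_mul_cancel₀ _ hlog2.ne']
  generalize Real.logb 2 3 = L at *
  have hα' : |α| ≤ 1 / 10 := abs_le.2 hα
  have hu : |-(2 / 3) * α| ≤ 0.07 := by
    rw [abs_mul, abs_of_neg (by norm_num)]; linarith
  have hv : |2 * (L - 1) * α| ≤ 0.16 := by
    rw [abs_mul, abs_of_pos (by linarith)]; nlinarith [abs_nonneg α]
  have hw : |-L * α| ≤ 0.16 := by
    rw [abs_mul, abs_of_neg (by linarith)]; nlinarith [abs_nonneg α]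
  have hu' := abs_le.1 hu
  have hv' := abs_le.1 hv
  have hw' := abs_le.1 hw
  have hS : Real.log (3 / 4 - α / 2) =
      (L - 2) * Real.log 2 + Real.log (1 + -(2 / 3) * α) := by
    rw [show 3 / 4 - α / 2 = 3 / 2 ^ 2 * (1 + -(2 / 3) * α) by ring,
      Real.log_mul (by norm_num) (by linarith), Real.log_div (by norm_num) (by norm_num),
      Real.log_pow, hlog3]
    push_cast; ring
  have hA : Real.log (1 / 4 + (L - 1) / 2 * α) =
      -2 * Real.log 2 + Real.log (1 + 2 * (L - 1) * α) := by
    rw [show 1 / 4 + (L - 1) / 2 * α = (2 ^ 2)⁻¹ * (1 + 2 * (L - 1) * α) by ring,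
      Real.log_mul (by norm_num) (by linarith), Real.log_inv, Real.log_pow]
    push_cast; ring
  have hB : Real.log (3 / 4 - α / 2 - (1 / 4 + (L - 1) / 2 * α)) =
      -Real.log 2 + Real.log (1 + -L * α) := by
    rw [show 3 / 4 - α / 2 - (1 / 4 + (L - 1) / 2 * α) = 2⁻¹ * (1 + -L * α) by ring,
      Real.log_mul (by norm_num) (by linarith), Real.log_inv]
  have hleft := mul_binEntropy_div_mul_log_two
    (a := 1 / 4 + (L - 1) / 2 * α) (s := 3 / 4 - α / 2) (by linarith) (by linarith)
  have hright := mul_binEntropy_div_mul_log_two (a := 1) (s := 3) (by norm_num) (by norm_num)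
  rw [hS, hA, hB] at hleft
  norm_num [hlog3] at hright
  have hU := one_add_mul_log_one_add_le hu
  have hV := le_one_add_mul_log_one_add hv
  have hW := le_one_add_mul_log_one_add hw
  have hcoef : 0.75 * 0.52 * (2 / 3) ^ 2 - 0.25 * 0.445 * (2 * (L - 1)) ^ 2
      - 0.5 * 0.445 * L ^ 2 + 0.7 * Real.log 2 ≤ 0 := by
    nlinarith [Real.log_two_lt_d9]
  have hquad := mul_nonpos_of_nonpos_of_nonneg hcoef (sq_nonneg α)
  refine le_of_mul_le_mul_right ?_ hlog2
  rw [hleft]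
  norm_num at *
  linarith
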